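/- arXiv:1811.11607 — 2 statements merged into one kernel-verified Lean document; each statement's English description precedes it below -/
import Mathlib

section
/- Let (f_n)_{n∈N₀} be a continuous subadditive cocycle over a topological dynamical system (X,T) with X a compact metric space, and define β[(f_n)] := sup_{x∈X} limsup_{n→∞} (1/n) f_n(x). Then β[(f_n)] = sup_{μ∈M_T} inf_{n>0} (1/n) ∫ f_n dμ = inf_{n>0} sup_{x∈X} (1/n) f_n(x) = inf_{n>0} sup_{μ∈M_T} (1/n) ∫ f_n dμ; moreover each infimum over n can be replaced by a limit as n → ∞, and every supremum is attained. -/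
open Filter MeasureTheory Metric Set
open scoped Manifold Topology ENNReal NNReal

noncomputable section

/-- The extremal growth rate `β[(f_n)] = sup_x limsup_n (1/n) f_n(x)` of a cocycle. -/
noncomputable def cocycleBeta {X : Type*} (f : ℕ → X → ℝ) : EReal :=
  ⨆ x : X, Filter.atTop.limsup fun n : ℕ => ((f n x / n : ℝ) : EReal)

/-- **Fekete's lemma** in the extended reals, without a lower bound. -/
theorem Subadditive.tendsto_div_iInf {u : ℕ → ℝ} (hu : Subadditive u) :
    Tendsto (fun n : ℕ => ((u n / n : ℝ) : EReal)) atTop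
      (𝓝 (⨅ n : {n : ℕ // 0 < n}, ((u n / n : ℝ) : EReal))) := by
  refine tendsto_order.2 ⟨fun a ha => ?_, fun a ha => ?_⟩
  · filter_upwards [eventually_gt_atTop 0] with n hn
    exact ha.trans_le (iInf_le (fun n : {n : ℕ // 0 < n} => ((u n / n : ℝ) : EReal)) ⟨n, hn⟩)
  · obtain ⟨⟨n, hn⟩, h⟩ := iInf_lt_iff.1 ha
    obtain ⟨c, hc, hca⟩ := EReal.lt_iff_exists_real_btwn.1 h
    filter_upwards [hu.eventually_div_lt_of_div_lt hn.ne' (EReal.coe_lt_coe_iff.1 hc)] with p hp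
    exact (EReal.coe_lt_coe_iff.2 hp).trans hca

/-- The uniform distribution on the first `n + 1` points of the orbit of `x`. -/
def empiricalMeasure {X : Type*} [MeasurableSpace X] (T : X → X) (x : X) (n : ℕ) : Measure X :=
  ((n + 1 : ℕ) : ℝ≥0∞)⁻¹ • ∑ i ∈ Finset.range (n + 1), Measure.dirac (T^[i] x)

instance {X : Type*} [MeasurableSpace X] (T : X → X) (x : X) (n : ℕ) :
    IsProbabilityMeasure (empiricalMeasure T x n) := by
  constructor
  simp only [empiricalMeasure, Measure.smul_apply, Measure.finsetSum_apply, measure_univ,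
    Finset.sum_const, Finset.card_range, nsmul_eq_mul, mul_one, smul_eq_mul]
  exact ENNReal.inv_mul_cancel (by simp) (ENNReal.natCast_ne_top _)

theorem integral_comp_iterate {X : Type*} [TopologicalSpace X] [MeasurableSpace X]
    [OpensMeasurableSpace X] {T : X → X} {μ : Measure X} (hμ : MeasurePreserving T μ μ)
    {g : X → ℝ} (hg : Continuous g) (n : ℕ) : ∫ x, g (T^[n] x) ∂μ = ∫ x, g x ∂μ := by
  have h := hμ.iterate n
  have := integral_map (μ := μ) h.measurable.aemeasurable
    (hg.aestronglyMeasurable (μ := μ.map T^[n]))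
  rw [← this, h.map_eq]

section CompactDynamics

variable {X : Type*} [MetricSpace X] [CompactSpace X] [MeasurableSpace X] [BorelSpace X]

theorem Continuous.integrable_of_compactSpace {g : X → ℝ} (hg : Continuous g) (μ : Measure X)
    [IsFiniteMeasure μ] : Integrable g μ :=
  hg.integrable_of_hasCompactSupport (HasCompactSupport.of_compactSpace g)

theorem integral_empiricalMeasure (T : X → X) {g : X → ℝ} (hg : Continuous g) (x : X) (n : ℕ) :
    ∫ y, g y ∂(empiricalMeasure T x n) = birkhoffAverage ℝ T g (n + 1) x := by
  rw [empiricalMeasure, integral_smul_measure,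
    integral_finsetSum_measure fun i _ => hg.integrable_of_compactSpace _]
  rw [ENNReal.toReal_inv, ENNReal.toReal_natCast]
  simp [birkhoffAverage, birkhoffSum]

/-- **Krylov–Bogolyubov**: along a suitable ultrafilter, Birkhoff averages of continuous functions
along an orbit converge to the integral against an invariant probability measure. -/
theorem exists_measurePreserving_tendsto_birkhoffAverage {T : X → X} (hT : Continuous T) (x : X) :
    ∃ (μ : Measure X) (U : Ultrafilter ℕ), IsProbabilityMeasure μ ∧ MeasurePreserving T μ μ ∧
      (U : Filter ℕ) ≤ atTop ∧ ∀ g : X → ℝ, Continuous g →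
        Tendsto (fun n : ℕ => birkhoffAverage ℝ T g (n + 1) x) U (𝓝 (∫ y, g y ∂μ)) := by
  let P : ℕ → ProbabilityMeasure X := fun n => ⟨empiricalMeasure T x n, inferInstance⟩
  let U : Ultrafilter ℕ := Ultrafilter.of atTop
  have hU : (U : Filter ℕ) ≤ atTop := Ultrafilter.of_le _
  obtain ⟨μ, -, hμ⟩ := isCompact_univ.ultrafilter_le_nhds (U.map P) (by simp)
  have key : ∀ g : X → ℝ, Continuous g →
      Tendsto (fun n : ℕ => birkhoffAverage ℝ T g (n + 1) x) U (𝓝 (∫ y, g y ∂(μ : Measure X))) := by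
    intro g hg
    have h := ProbabilityMeasure.tendsto_iff_forall_integral_tendsto.1
      (show Tendsto P U (𝓝 μ) from hμ) (BoundedContinuousFunction.mkOfCompact ⟨g, hg⟩)
    refine h.congr fun n => ?_
    exact integral_empiricalMeasure T hg x n
  refine ⟨μ, U, inferInstance, ⟨hT.measurable, ?_⟩, hU, key⟩
  have : IsFiniteMeasure ((μ : Measure X).map T) := inferInstance
  refine ext_of_forall_integral_eq_of_IsFiniteMeasure fun g => ?_
  rw [integral_map hT.aemeasurable g.continuous.aestronglyMeasurable]
  refine sub_eq_zero.1 (tendsto_nhds_unique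
    ((key (fun y => g (T y)) (g.continuous.comp hT)).sub (key g g.continuous)) ?_)
  have hbd : Bornology.IsBounded (range fun n => g (T^[n] x)) :=
    g.isBounded_range.subset (range_comp_subset_range (fun n => T^[n] x) g)
  refine (((tendsto_birkhoffAverage_apply_sub_birkhoffAverage ℝ hbd).comp
    (tendsto_add_atTop_nat 1)).mono_left hU).congr fun n => ?_
  simp [birkhoffAverage, birkhoffSum, Function.iterate_succ_apply, ← Function.iterate_succ_apply']

end CompactDynamics

section Cocycle

variable {X : Type*} {T : X → X} {f : ℕ → X → ℝ}

/-- Telescoping comparison of a subadditive cocycle with the Birkhoff sums of its `m`-th term. -/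
theorem sum_cocycle_add_le_birkhoffSum
    (hsub : ∀ (n m : ℕ) (x : X), f (n + m) x ≤ f n x + f m (T^[n] x)) (m n : ℕ) (x : X) :
    ∑ j ∈ Finset.range m, f (n + j) x ≤
      ∑ j ∈ Finset.range m, f j x + birkhoffSum T (f m) n x := by
  induction n with
  | zero => simp
  | succ n ih =>
    have h1 := Finset.sum_range_succ' (fun j => f (n + j) x) m
    rw [Finset.sum_range_succ] at h1
    have h2 : ∑ j ∈ Finset.range m, f (n + 1 + j) x = ∑ j ∈ Finset.range m, f (n + (j + 1)) x :=
      Finset.sum_congr rfl fun j _ => by rw [add_assoc, add_comm 1 j]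
    rw [h2, birkhoffSum_succ]
    have h3 := hsub n m x
    simp only [add_zero] at h1
    linarith

variable [MetricSpace X] [CompactSpace X]

theorem subadditive_iSup_cocycle [Nonempty X] (hf : ∀ n, Continuous (f n))
    (hsub : ∀ (n m : ℕ) (x : X), f (n + m) x ≤ f n x + f m (T^[n] x)) :
    Subadditive fun n => ⨆ x, f n x := fun m n =>
  ciSup_le fun x => (hsub m n x).trans <| add_le_add
    (le_ciSup (isCompact_range (hf m)).bddAbove x)
    (le_ciSup (isCompact_range (hf n)).bddAbove (T^[m] x))

/-- If no orbit grows at rate at least `b` at all times, the cocycle has a uniformly smaller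
linear upper bound. -/
theorem exists_forall_cocycle_le (hf : ∀ n, Continuous (f n))
    (hsub : ∀ (n m : ℕ) (x : X), f (n + m) x ≤ f n x + f m (T^[n] x)) {b : ℝ}
    (hb : ∀ x, ∃ n, 0 < n ∧ f n x < b * n) :
    ∃ c C : ℝ, c < b ∧ ∀ n x, f n x ≤ c * n + C := by
  let V : ℕ → Set X := fun k =>
    ⋃ n ∈ Finset.Icc 1 k, {x | f n x < (b - 1 / ((k : ℝ) + 1)) * n}
  have hVo : ∀ k, IsOpen (V k) := fun k =>
    isOpen_biUnion fun n _ => isOpen_lt (hf n) continuous_const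
  have hVm : Monotone V := by
    intro k l hkl x hx
    simp only [V, mem_iUnion, Finset.mem_Icc, mem_ofPred_eq, exists_prop] at hx ⊢
    obtain ⟨n, hn, hx⟩ := hx
    refine ⟨n, ⟨hn.1, hn.2.trans hkl⟩, hx.trans_le ?_⟩
    gcongr
  have hVc : univ ⊆ ⋃ k, V k := by
    intro x _
    obtain ⟨n, hn, hx⟩ := hb x
    have hn' : (0 : ℝ) < n := Nat.cast_pos.2 hn
    obtain ⟨k, hk⟩ := exists_nat_one_div_lt (sub_pos.2 ((div_lt_iff₀ hn').2 hx))
    simp only [V, mem_iUnion, Finset.mem_Icc, mem_ofPred_eq, exists_prop]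
    refine ⟨max k n, n, ⟨hn, le_max_right _ _⟩, (div_lt_iff₀ hn').1 ?_⟩
    have : 1 / (((max k n : ℕ) : ℝ) + 1) ≤ 1 / ((k : ℝ) + 1) := by
      gcongr
      exact le_max_left _ _
    linarith
  obtain ⟨k, hk⟩ := isCompact_univ.elim_directed_cover V hVo hVc hVm.directed_le
  set c := b - 1 / ((k : ℝ) + 1)
  have hbd : ∀ n, ∃ A : ℝ, ∀ x, f n x - c * n ≤ A := fun n =>
    ((isCompact_range (hf n)).bddAbove).elim fun A hA =>
      ⟨A - c * n, fun x => sub_le_sub_right (hA (mem_range_self x)) _⟩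
  choose A hA using hbd
  refine ⟨c, ∑ r ∈ Finset.range (k + 1), |A r|, sub_lt_self b Nat.one_div_pos_of_nat, fun n => ?_⟩
  induction n using Nat.strong_induction_on with
  | _ n ih =>
    intro x
    obtain hnk | hnk := le_or_gt n k
    · have h1 : |A n| ≤ ∑ r ∈ Finset.range (k + 1), |A r| :=
        Finset.single_le_sum (f := fun r => |A r|) (fun r _ => abs_nonneg _)
          (Finset.mem_range.2 (Nat.lt_succ_of_le hnk))
      linarith [hA n x, le_abs_self (A n)]
    · have hx := hk (mem_univ x)
      simp only [V, mem_iUnion, Finset.mem_Icc, mem_ofPred_eq, exists_prop] at hx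
      obtain ⟨m, hm, hx⟩ := hx
      have h1 := ih (n - m) (by omega) (T^[m] x)
      have h2 := hsub m (n - m) x
      rw [Nat.add_sub_cancel' (by omega)] at h2
      rw [Nat.cast_sub (by omega)] at h1
      linarith

/-- Some orbit realises the uniform growth rate at all times. -/
theorem exists_forall_iInf_le_cocycle [Nonempty X] (hf : ∀ n, Continuous (f n))
    (hsub : ∀ (n m : ℕ) (x : X), f (n + m) x ≤ f n x + f m (T^[n] x)) :
    ∃ x, ∀ m : ℕ, 0 < m →
      (⨅ n : {n : ℕ // 0 < n}, (((⨆ y, f n y) / n : ℝ) : EReal)) ≤ ((f m x / m : ℝ) : EReal) := by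
  generalize hβ : (⨅ n : {n : ℕ // 0 < n}, (((⨆ y, f n y) / n : ℝ) : EReal)) = β
  have hlim := (subadditive_iSup_cocycle hf hsub).tendsto_div_iInf
  rw [hβ] at hlim
  have hle : ∀ n : ℕ, 0 < n → β ≤ (((⨆ y, f n y) / n : ℝ) : EReal) := fun n hn =>
    hβ ▸ iInf_le (fun n : {n : ℕ // 0 < n} => (((⨆ y, f n y) / n : ℝ) : EReal)) ⟨n, hn⟩
  induction β using EReal.rec with
  | bot => exact ⟨Classical.arbitrary X, fun _ _ => bot_le⟩
  | top => exact absurd (hle 1 one_pos) (by simp)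
  | coe b =>
    by_contra! hcon
    obtain ⟨c, C, hcb, hC⟩ := exists_forall_cocycle_le hf hsub (b := b) fun x => by
      obtain ⟨n, hn, h⟩ := hcon x
      exact ⟨n, hn, (div_lt_iff₀ (Nat.cast_pos.2 hn)).1 (EReal.coe_lt_coe_iff.1 h)⟩
    have h0 : Tendsto (fun n : ℕ => c + C / (n : ℝ)) atTop (𝓝 (c + 0)) :=
      tendsto_const_nhds.add (tendsto_const_div_atTop_nhds_zero_nat C)
    rw [add_zero] at h0
    refine hcb.not_ge (ge_of_tendsto h0 ?_)
    filter_upwards [eventually_gt_atTop 0] with n hn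
    have hn' : (0 : ℝ) < n := Nat.cast_pos.2 hn
    refine (EReal.coe_le_coe_iff.1 (hle n hn)).trans ?_
    rw [div_le_iff₀ hn', add_mul, div_mul_cancel₀ _ hn'.ne']
    exact ciSup_le (hC n)

theorem integral_cocycle_div_le_iSup_div [Nonempty X] [MeasurableSpace X] [BorelSpace X]
    (hf : ∀ n, Continuous (f n)) (μ : Measure X) [IsProbabilityMeasure μ] (n : ℕ) :
    (∫ x, f n x ∂μ) / n ≤ (⨆ x, f n x) / n := by
  gcongr
  have h := integral_mono ((hf n).integrable_of_compactSpace μ) (integrable_const (⨆ x, f n x))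
    fun x => le_ciSup (isCompact_range (hf n)).bddAbove x
  simpa using h

/-- Some invariant measure realises the uniform growth rate at all times. -/
theorem exists_measurePreserving_forall_iInf_le_integral_cocycle [Nonempty X] [MeasurableSpace X]
    [BorelSpace X] (hT : Continuous T) (hf : ∀ n, Continuous (f n))
    (hsub : ∀ (n m : ℕ) (x : X), f (n + m) x ≤ f n x + f m (T^[n] x)) :
    ∃ μ : {μ : Measure X // IsProbabilityMeasure μ ∧ MeasurePreserving T μ μ},
      ∀ m : ℕ, 0 < m →
        (⨅ n : {n : ℕ // 0 < n}, (((⨆ y, f n y) / n : ℝ) : EReal)) ≤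
          (((∫ x, f m x ∂μ.1) / m : ℝ) : EReal) := by
  obtain ⟨x, hx⟩ := exists_forall_iInf_le_cocycle hf hsub
  obtain ⟨μ, U, hμ, hinv, hU, hlim⟩ := exists_measurePreserving_tendsto_birkhoffAverage hT x
  refine ⟨⟨μ, hμ, hinv⟩, fun m hm => ?_⟩
  have htop := iInf_le (fun n : {n : ℕ // 0 < n} => (((⨆ y, f n y) / n : ℝ) : EReal)) ⟨1, one_pos⟩
  generalize (⨅ n : {n : ℕ // 0 < n}, (((⨆ y, f n y) / n : ℝ) : EReal)) = β at hx htop ⊢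
  induction β using EReal.rec with
  | bot => exact bot_le
  | top => exact absurd htop (by simp)
  | coe b =>
    have hb : ∀ n : ℕ, 0 < n → b * n ≤ f n x := fun n hn =>
      (le_div_iff₀ (Nat.cast_pos.2 hn)).1 (EReal.coe_le_coe_iff.1 (hx n hn))
    refine EReal.coe_le_coe_iff.2 ((le_div_iff₀ (Nat.cast_pos.2 hm)).2 ?_)
    set D : ℝ := ∑ j ∈ Finset.range m, (b * j - f j x) with hD
    have h0 : Tendsto (fun n : ℕ => b * m + D / ((n + 1 : ℕ) : ℝ)) U (𝓝 (b * m + 0)) :=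
      (tendsto_const_nhds.add ((tendsto_const_div_atTop_nhds_zero_nat D).comp
        (tendsto_add_atTop_nat 1))).mono_left hU
    rw [add_zero] at h0
    refine le_of_tendsto_of_tendsto' h0 (hlim (f m) (hf m)) fun n => ?_
    have hn' : (0 : ℝ) < (n + 1 : ℕ) := Nat.cast_pos.2 n.succ_pos
    have h1 := sum_cocycle_add_le_birkhoffSum hsub m (n + 1) x
    have h2 : ∑ j ∈ Finset.range m, b * ((n + 1 + j : ℕ) : ℝ) ≤
        ∑ j ∈ Finset.range m, f (n + 1 + j) x := Finset.sum_le_sum fun j _ => hb _ (by omega)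
    have h3 : ∑ j ∈ Finset.range m, b * ((n + 1 + j : ℕ) : ℝ) =
        b * m * (n + 1 : ℕ) + ∑ j ∈ Finset.range m, b * (j : ℝ) := by
      simp only [Nat.cast_add (n + 1), mul_add, Finset.sum_add_distrib, Finset.sum_const,
        Finset.card_range, nsmul_eq_mul]
      ring
    rw [hD, Finset.sum_sub_distrib, birkhoffAverage, smul_eq_mul, ← div_eq_inv_mul,
      le_div_iff₀ hn', add_mul, div_mul_cancel₀ _ hn'.ne']
    linarith

/-- A continuous function has a maximising invariant probability measure. -/
theorem exists_measurePreserving_forall_integral_le [Nonempty X] [MeasurableSpace X]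
    [BorelSpace X] (hT : Continuous T) {g : X → ℝ} (hg : Continuous g) :
    ∃ μ : {μ : Measure X // IsProbabilityMeasure μ ∧ MeasurePreserving T μ μ},
      ∀ ν : {ν : Measure X // IsProbabilityMeasure ν ∧ MeasurePreserving T ν ν},
        ∫ x, g x ∂ν.1 ≤ ∫ x, g x ∂μ.1 := by
  have hF : ∀ n, Continuous (birkhoffSum T g n) := fun n =>
    continuous_finsetSum _ fun i _ => hg.comp (hT.iterate i)
  obtain ⟨μ, hμ⟩ := exists_measurePreserving_forall_iInf_le_integral_cocycle hT hF
    fun n m x => (birkhoffSum_add T g n m x).le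
  refine ⟨μ, fun ν => ?_⟩
  have hν := ν.2.1
  refine EReal.coe_le_coe_iff.1 (le_trans (le_iInf fun n => ?_) ((hμ 1 one_pos).trans_eq
    (by simp)))
  refine EReal.coe_le_coe_iff.2 (le_trans (le_of_eq ?_)
    (integral_cocycle_div_le_iSup_div hF ν.1 n))
  have hn : ((n : ℕ) : ℝ) ≠ 0 := Nat.cast_ne_zero.2 n.2.ne'
  rw [eq_div_iff hn]
  simp only [birkhoffSum]
  rw [integral_finsetSum (f := fun i x => g (T^[i] x)) _
    fun i _ => (hg.comp (hT.iterate i)).integrable_of_compactSpace ν.1]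
  simp [integral_comp_iterate ν.2.2 hg, mul_comm]

theorem exists_div_eq_iSup_div {X : Type*} [TopologicalSpace X] [CompactSpace X] [Nonempty X]
    {g : X → ℝ} (hg : Continuous g) (n : ℕ) :
    ∃ x, g x / n = (⨆ y, g y) / n ∧
      (((⨆ y, g y) / n : ℝ) : EReal) = ⨆ y, ((g y / n : ℝ) : EReal) := by
  have hbdd := (isCompact_range hg).bddAbove
  obtain ⟨x, -, hx⟩ := isCompact_univ.exists_isMaxOn univ_nonempty hg.continuousOn
  have hx' : g x = ⨆ y, g y := le_antisymm (le_ciSup hbdd x) (ciSup_le fun y => hx (mem_univ y))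
  refine ⟨x, by rw [hx'], le_antisymm ?_ (iSup_le fun y => EReal.coe_le_coe_iff.2 ?_)⟩
  · rw [← hx']
    exact le_iSup (fun y => ((g y / n : ℝ) : EReal)) x
  · gcongr
    exact le_ciSup hbdd y

end Cocycle

/-- For a continuous subadditive cocycle `(f_n)` over a topological
dynamical system `(X,T)` on a compact metric space, the extremal growth rate `β[(f_n)]`
equals `sup_μ inf_{n>0} (1/n)∫f_n dμ = inf_{n>0} sup_x (1/n) f_n(x)
= inf_{n>0} sup_μ (1/n)∫f_n dμ`, the infima can be replaced by limits, and every
supremum is attained. Here `μ` ranges over the `T`-invariant Borel probability measures. -/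
theorem cocycle_extremal_growth_rate {X : Type*} [MetricSpace X] [CompactSpace X]
    [Nonempty X] [MeasurableSpace X] [BorelSpace X]
    (T : X → X) (hT : Continuous T) (f : ℕ → X → ℝ)
    (hf : ∀ n, Continuous (f n))
    (hsub : ∀ (n m : ℕ) (x : X), f (n + m) x ≤ f n x + f m (T^[n] x)) :
    (cocycleBeta f =
      ⨆ μ : {μ : Measure X // IsProbabilityMeasure μ ∧ MeasurePreserving T μ μ},
        ⨅ n : {n : ℕ // 0 < n}, (((∫ x, f n x ∂μ.1) / n : ℝ) : EReal)) ∧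
    (cocycleBeta f =
      ⨅ n : {n : ℕ // 0 < n}, ⨆ x : X, ((f n x / n : ℝ) : EReal)) ∧
    (cocycleBeta f =
      ⨅ n : {n : ℕ // 0 < n},
        ⨆ μ : {μ : Measure X // IsProbabilityMeasure μ ∧ MeasurePreserving T μ μ},
          (((∫ x, f n x ∂μ.1) / n : ℝ) : EReal)) ∧
    -- the infima can be replaced by limits:
    (∀ μ : {μ : Measure X // IsProbabilityMeasure μ ∧ MeasurePreserving T μ μ},
      Tendsto (fun n : ℕ => (((∫ x, f n x ∂μ.1) / n : ℝ) : EReal)) atTop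
        (𝓝 (⨅ n : {n : ℕ // 0 < n}, (((∫ x, f n x ∂μ.1) / n : ℝ) : EReal)))) ∧
    (Tendsto (fun n : ℕ => ⨆ x : X, ((f n x / n : ℝ) : EReal)) atTop (𝓝 (cocycleBeta f))) ∧
    (Tendsto (fun n : ℕ =>
        ⨆ μ : {μ : Measure X // IsProbabilityMeasure μ ∧ MeasurePreserving T μ μ},
          (((∫ x, f n x ∂μ.1) / n : ℝ) : EReal)) atTop (𝓝 (cocycleBeta f))) ∧
    -- every supremum is attained:
    (∃ x : X, (Filter.atTop.limsup fun n : ℕ => ((f n x / n : ℝ) : EReal)) = cocycleBeta f) ∧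
    (∃ μ : {μ : Measure X // IsProbabilityMeasure μ ∧ MeasurePreserving T μ μ},
      (⨅ n : {n : ℕ // 0 < n}, (((∫ x, f n x ∂μ.1) / n : ℝ) : EReal)) = cocycleBeta f) ∧
    (∀ n : {n : ℕ // 0 < n}, ∃ x : X,
      ((f n x / (n : ℕ) : ℝ) : EReal) = ⨆ y : X, ((f n y / (n : ℕ) : ℝ) : EReal)) ∧
    (∀ n : {n : ℕ // 0 < n},
      ∃ μ : {μ : Measure X // IsProbabilityMeasure μ ∧ MeasurePreserving T μ μ},
        (((∫ x, f n x ∂μ.1) / (n : ℕ) : ℝ) : EReal) =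
          ⨆ ν : {ν : Measure X // IsProbabilityMeasure ν ∧ MeasurePreserving T ν ν},
            (((∫ x, f n x ∂ν.1) / (n : ℕ) : ℝ) : EReal)) := by
  set β : EReal := ⨅ n : {n : ℕ // 0 < n}, (((⨆ y, f n y) / n : ℝ) : EReal) with hβ
  have hsup : ∀ n : ℕ, (⨆ x, ((f n x / n : ℝ) : EReal)) = (((⨆ y, f n y) / n : ℝ) : EReal) :=
    fun n => (exists_div_eq_iSup_div (hf n) n).choose_spec.2.symm
  have hlim : Tendsto (fun n : ℕ => (((⨆ y, f n y) / n : ℝ) : EReal)) atTop (𝓝 β) :=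
    (subadditive_iSup_cocycle hf hsub).tendsto_div_iInf
  obtain ⟨x, hx⟩ := exists_forall_iInf_le_cocycle hf hsub
  obtain ⟨μ, hμ⟩ := exists_measurePreserving_forall_iInf_le_integral_cocycle hT hf hsub
  rw [← hβ] at hx hμ
  have hxle : ∀ y, (atTop.limsup fun n : ℕ => ((f n y / n : ℝ) : EReal)) ≤ β := fun y => by
    rw [← hlim.limsup_eq]
    refine limsup_le_limsup (Eventually.of_forall fun n => ?_)
    simp only [← hsup]
    exact le_iSup (fun y => ((f n y / n : ℝ) : EReal)) y
  have hxeq : (atTop.limsup fun n : ℕ => ((f n x / n : ℝ) : EReal)) = β := by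
    refine le_antisymm (hxle x) (le_limsup_of_frequently_le (Eventually.frequently ?_))
    filter_upwards [eventually_gt_atTop 0] with n hn using hx n hn
  have hbeta : cocycleBeta f = β := le_antisymm (iSup_le hxle)
    (hxeq.symm.trans_le
      (le_iSup (fun y => atTop.limsup fun n : ℕ => ((f n y / n : ℝ) : EReal)) x))
  have hνle : ∀ (ν : {μ : Measure X // IsProbabilityMeasure μ ∧ MeasurePreserving T μ μ}) (n : ℕ),
      (((∫ x, f n x ∂ν.1) / n : ℝ) : EReal) ≤ (((⨆ y, f n y) / n : ℝ) : EReal) := fun ν n =>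
    have := ν.2.1
    EReal.coe_le_coe_iff.2 (integral_cocycle_div_le_iSup_div hf ν.1 n)
  have hνinf : ∀ ν : {μ : Measure X // IsProbabilityMeasure μ ∧ MeasurePreserving T μ μ},
      (⨅ n : {n : ℕ // 0 < n}, (((∫ x, f n x ∂ν.1) / n : ℝ) : EReal)) ≤ β := fun ν =>
    iInf_mono fun n => hνle ν n
  have hμeq : (⨅ n : {n : ℕ // 0 < n}, (((∫ x, f n x ∂μ.1) / n : ℝ) : EReal)) = β :=
    le_antisymm (hνinf μ) (le_iInf fun n => hμ n n.2)
  have hβle : ∀ n : ℕ, 0 < n → β ≤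
      ⨆ ν : {μ : Measure X // IsProbabilityMeasure μ ∧ MeasurePreserving T μ μ},
        (((∫ x, f n x ∂ν.1) / n : ℝ) : EReal) := fun n hn =>
    le_iSup_of_le μ (hμ n hn)
  rw [hbeta]
  refine ⟨?_, ?_, ?_, fun ν => ?_, ?_, ?_, ⟨x, hxeq⟩, ⟨μ, hμeq⟩, fun n => ?_, fun n => ?_⟩
  · exact le_antisymm (le_iSup_of_le μ hμeq.ge) (iSup_le hνinf)
  · simp only [hsup, hβ]
  · exact le_antisymm (le_iInf fun n => hβle n n.2) (iInf_mono fun n => iSup_le fun ν => hνle ν n)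
  · have := ν.2.1
    refine Subadditive.tendsto_div_iInf fun m n => ?_
    have hi : Integrable (fun x => f n (T^[m] x)) ν.1 :=
      ((hf n).comp (hT.iterate m)).integrable_of_compactSpace ν.1
    calc ∫ x, f (m + n) x ∂ν.1 ≤ ∫ x, (f m x + f n (T^[m] x)) ∂ν.1 :=
          integral_mono ((hf _).integrable_of_compactSpace _)
            (((hf m).integrable_of_compactSpace _).add hi) (hsub m n)
      _ = ∫ x, f m x ∂ν.1 + ∫ x, f n x ∂ν.1 := by
          rw [integral_add ((hf m).integrable_of_compactSpace _) hi,
            integral_comp_iterate ν.2.2 (hf n)]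
  · simpa only [hsup] using hlim
  · refine tendsto_of_tendsto_of_tendsto_of_le_of_le' tendsto_const_nhds hlim ?_
      (Eventually.of_forall fun n => iSup_le fun ν => hνle ν n)
    filter_upwards [eventually_gt_atTop 0] with n hn using hβle n hn
  · obtain ⟨y, hy, hy'⟩ := exists_div_eq_iSup_div (hf n) n
    exact ⟨y, by rw [hy, hy']⟩
  · obtain ⟨ν, hν⟩ := exists_measurePreserving_forall_integral_le hT (hf n)
    refine ⟨ν, le_antisymm (le_iSup (fun ν : {ν : Measure X // IsProbabilityMeasure ν ∧
      MeasurePreserving T ν ν} => (((∫ x, f n x ∂ν.1) / (n : ℕ) : ℝ) : EReal)) ν)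
      (iSup_le fun ρ => EReal.coe_le_coe_iff.2 ?_)⟩
    exact div_le_div_of_nonneg_right (hν ρ) (Nat.cast_nonneg _)

end
end

section
/- Let A ∈ Z^{2×2} be an integer matrix with |det A| = 1 whose eigenvalues λ₁, λ₂ satisfy |λ₁| > 1 > |λ₂|, and let T_A : T² → T² be the induced hyperbolic linear automorphism of the 2-torus, T_A(x) = Ax (mod Z²). Then h_rst(T_A) = log|λ₁| = h_top(T_A). -/
open Filter MeasureTheory Metric Set
open scoped Manifold Topology ENNReal NNReal

noncomputable section

/-! ### Covering and separated numbers, entropies on metric spaces -/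

section MetricDefs

variable {X : Type*} [MetricSpace X]

/-- The smallest number of `ε`-balls needed to cover `A`. -/
noncomputable def coverNum (A : Set X) (ε : ℝ) : ℕ :=
  sInf {k | ∃ s : Finset X, (A ⊆ ⋃ y ∈ s, Metric.ball y ε) ∧ s.card = k}

/-- `p(n,x,ε;T)`: the smallest number of `ε`-balls needed to cover `T^n(B_ε(x) ∩ K)`. -/
noncomputable def restNum (T : X → X) (K : Set X) (n : ℕ) (x : X) (ε : ℝ) : ℕ :=
  coverNum (T^[n] '' (Metric.ball x ε ∩ K)) ε

/-- Restoration entropy of `T` on the forward-invariant set `K` (logarithms base 2). -/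
noncomputable def restEntropyOn (T : X → X) (K : Set X) : EReal :=
  Filter.atTop.limsup fun n : ℕ =>
    ((n : ℝ)⁻¹ : EReal) *
      Filter.limsup (fun ε : ℝ => ⨆ x : X, ((Real.logb 2 (restNum T K n x ε) : ℝ) : EReal))
        (nhdsWithin 0 (Set.Ioi 0))

/-- Restoration entropy of `T` on the whole space. -/
noncomputable def restEntropy (T : X → X) : EReal := restEntropyOn T Set.univ

/-- `F` is an `(n,ε,T)`-separated subset of `K`. -/
def IsDynSeparated (T : X → X) (K : Set X) (n : ℕ) (ε : ℝ) (F : Finset X) : Prop :=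
  ↑F ⊆ K ∧ ∀ x ∈ F, ∀ y ∈ F, x ≠ y → ∃ i < n, ε ≤ dist (T^[i] x) (T^[i] y)

/-- Maximal cardinality of an `(n,ε,T)`-separated subset of `K`. -/
noncomputable def sepNum (T : X → X) (K : Set X) (n : ℕ) (ε : ℝ) : ℕ :=
  sSup {k | ∃ F : Finset X, IsDynSeparated T K n ε F ∧ F.card = k}

/-- Bowen–Dinaburg topological entropy of `T` on `K` (logarithms base 2);
the limit as `ε ↓ 0` is realized as the supremum over `ε > 0` by monotonicity. -/
noncomputable def topEntropyOn (T : X → X) (K : Set X) : EReal :=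
  ⨆ ε : Set.Ioi (0 : ℝ),
    Filter.atTop.limsup fun n : ℕ => ((Real.logb 2 (sepNum T K n ε ) / n : ℝ) : EReal)

noncomputable def topEntropy (T : X → X) : EReal := topEntropyOn T Set.univ

end MetricDefs

/-! ### The 2-torus `T² = ℝ²/ℤ²` and linear toral automorphisms -/

/-- The 2-torus `ℝ²/ℤ²`. -/
abbrev Torus2 : Type := UnitAddCircle × UnitAddCircle

/-- The canonical projection `ℝ² → T²`. -/
def torusMk (v : ℝ × ℝ) : Torus2 := ((v.1 : UnitAddCircle), (v.2 : UnitAddCircle))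

/-- The toral map induced by an integer matrix `A`, `x ↦ Ax (mod ℤ²)`. -/
noncomputable def torusMatMap (A : Matrix (Fin 2) (Fin 2) ℤ) (p : Torus2) : Torus2 :=
  (A 0 0 • p.1 + A 0 1 • p.2, A 1 0 • p.1 + A 1 1 • p.2)

/-! ### Counting in balls -/

section Counting

variable {X : Type*} [MetricSpace X]

theorem coverNum_le_card {S : Set X} {ε : ℝ} {s : Finset X}
    (h : S ⊆ ⋃ y ∈ s, Metric.ball y ε) : coverNum S ε ≤ s.card :=
  Nat.sInf_le ⟨s, h, rfl⟩

theorem card_le_coverNum [CompactSpace X] {S : Set X} {ε : ℝ} (hε : 0 < ε) {P : Finset X}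
    (hP : ↑P ⊆ S) (hsep : ∀ x ∈ P, ∀ y ∈ P, x ≠ y → 2 * ε ≤ dist x y) :
    P.card ≤ coverNum S ε := by
  obtain ⟨t, -, ht, hcov⟩ := finite_cover_balls_of_compact (isCompact_univ (X := X)) hε
  have hne : {k | ∃ s : Finset X, (S ⊆ ⋃ y ∈ s, Metric.ball y ε) ∧ s.card = k}.Nonempty := by
    refine ⟨_, ht.toFinset, ?_, rfl⟩
    simpa using (subset_univ S).trans hcov
  obtain ⟨s, hs, hcard⟩ := Nat.sInf_mem hne
  change P.card ≤ sInf _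
  rw [← hcard]
  have hex : ∀ x ∈ P, ∃ y ∈ s, x ∈ Metric.ball y ε := fun x hx => by
    simpa using hs (hP hx)
  choose! g hgs hg using hex
  refine Finset.card_le_card_of_injOn g (fun x hx => hgs x hx) ?_
  intro x hx y hy hxy
  by_contra hne
  have h1 := hsep x hx y hy hne
  have h2 := Metric.mem_ball.1 (hg x hx)
  have h3 := Metric.mem_ball.1 (hg y hy)
  rw [← hxy] at h3
  linarith [dist_triangle_right x y (g x)]

theorem sepNum_le {T : X → X} {K : Set X} {n : ℕ} {ε : ℝ} {N : ℕ}
    (h : ∀ F : Finset X, IsDynSeparated T K n ε F → F.card ≤ N) : sepNum T K n ε ≤ N :=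
  csSup_le ⟨0, ∅, by simp [IsDynSeparated], rfl⟩ (by rintro _ ⟨F, hF, rfl⟩; exact h F hF)

theorem card_le_sepNum {T : X → X} {K : Set X} {n : ℕ} {ε : ℝ} {N : ℕ}
    (h : ∀ F : Finset X, IsDynSeparated T K n ε F → F.card ≤ N) {F : Finset X}
    (hF : IsDynSeparated T K n ε F) : F.card ≤ sepNum T K n ε :=
  le_csSup ⟨N, by rintro _ ⟨F, hF, rfl⟩; exact h F hF⟩ ⟨F, hF, rfl⟩

end Counting

/-! ### Exponential growth rates -/

theorem logb_natCast_le {N n : ℕ} {C L : ℝ} (hC : 1 ≤ C) (hL : 1 < L)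
    (h : (N : ℝ) ≤ C * L ^ n) : Real.logb 2 N ≤ Real.logb 2 C + n * Real.logb 2 L := by
  have hpow : 1 ≤ L ^ n := one_le_pow₀ hL.le
  have heq : Real.logb 2 (C * L ^ n) = Real.logb 2 C + n * Real.logb 2 L := by
    rw [Real.logb_mul (by positivity) (by positivity), Real.logb_pow]
  rw [← heq]
  rcases Nat.eq_zero_or_pos N with rfl | hN
  · simpa using Real.logb_nonneg one_lt_two (one_le_mul_of_one_le_of_one_le hC hpow)
  · exact Real.logb_le_logb_of_le one_lt_two (by exact_mod_cast hN) h

theorem le_logb_natCast {N n : ℕ} {c L : ℝ} (hc : 0 < c) (hL : 1 < L)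
    (h : c * L ^ n ≤ N) : Real.logb 2 c + n * Real.logb 2 L ≤ Real.logb 2 N := by
  have heq : Real.logb 2 (c * L ^ n) = Real.logb 2 c + n * Real.logb 2 L := by
    rw [Real.logb_mul (by positivity) (by positivity), Real.logb_pow]
  rw [← heq]
  exact Real.logb_le_logb_of_le one_lt_two (by positivity) h

theorem limsup_inv_mul_add (c l : ℝ) :
    atTop.limsup (fun n : ℕ => (((n : ℝ)⁻¹ * (c + n * l) : ℝ) : EReal)) = (l : EReal) := by
  refine Tendsto.limsup_eq ((continuous_coe_real_ereal.tendsto l).comp ?_)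
  have h : Tendsto (fun n : ℕ => (n : ℝ)⁻¹ * c + l) atTop (𝓝 (0 * c + l)) :=
    ((tendsto_inv_atTop_zero.comp tendsto_natCast_atTop_atTop).mul_const c).add_const l
  rw [zero_mul, zero_add] at h
  refine h.congr' ?_
  filter_upwards [eventually_gt_atTop 0] with n hn
  have : (n : ℝ) ≠ 0 := by positivity
  field_simp

section Growth

variable {X : Type*} [MetricSpace X] {T : X → X} {C c L : ℝ}

theorem restEntropy_le (hC : 1 ≤ C) (hL : 1 < L)
    (h : ∀ (n : ℕ) (ε : ℝ), 0 < ε → ∀ x, (restNum T univ n x ε : ℝ) ≤ C * L ^ n) :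
    restEntropy T ≤ (Real.logb 2 L : EReal) := by
  rw [← limsup_inv_mul_add (Real.logb 2 C)]
  refine limsup_le_limsup (Eventually.of_forall fun n => ?_)
  simp only [EReal.coe_mul]
  refine mul_le_mul_of_nonneg_left ?_ (EReal.inv_nonneg_of_nonneg (by positivity))
  refine limsup_le_of_le ?_ ?_
  · isBoundedDefault
  · filter_upwards [self_mem_nhdsWithin] with ε hε
    exact iSup_le fun x => EReal.coe_le_coe_iff.2 (logb_natCast_le hC hL (h n ε hε x))

theorem le_restEntropy (hc : 0 < c) (hL : 1 < L)
    (h : ∀ n : ℕ, ∀ᶠ ε in 𝓝[>] (0 : ℝ), ∃ x, c * L ^ n ≤ restNum T univ n x ε) :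
    (Real.logb 2 L : EReal) ≤ restEntropy T := by
  rw [← limsup_inv_mul_add (Real.logb 2 c)]
  refine limsup_le_limsup (Eventually.of_forall fun n => ?_)
  simp only [EReal.coe_mul]
  refine mul_le_mul_of_nonneg_left ?_ (EReal.coe_nonneg.2 (by positivity))
  refine le_limsup_of_frequently_le (Eventually.frequently ?_) ?_
  · filter_upwards [h n] with ε ⟨x, hx⟩
    exact le_iSup_of_le x (EReal.coe_le_coe_iff.2 (le_logb_natCast hc hL hx))
  · isBoundedDefault

theorem topEntropy_le (hL : 1 < L)
    (h : ∀ ε : ℝ, 0 < ε → ∃ C, 1 ≤ C ∧ ∀ n, (sepNum T univ n ε : ℝ) ≤ C * L ^ n) :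
    topEntropy T ≤ (Real.logb 2 L : EReal) := by
  refine iSup_le fun ⟨ε, hε⟩ => ?_
  obtain ⟨C, hC, hn⟩ := h ε hε
  rw [← limsup_inv_mul_add (Real.logb 2 C)]
  refine limsup_le_limsup (Eventually.of_forall fun n => EReal.coe_le_coe_iff.2 ?_)
  rw [div_eq_inv_mul]
  exact mul_le_mul_of_nonneg_left (logb_natCast_le hC hL (hn n)) (by positivity)

theorem le_topEntropy {ε : ℝ} (hε : 0 < ε) (hc : 0 < c) (hL : 1 < L)
    (h : ∀ n, c * L ^ n ≤ sepNum T univ n ε) : (Real.logb 2 L : EReal) ≤ topEntropy T := by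
  refine le_iSup_of_le (⟨ε, hε⟩ : Set.Ioi (0 : ℝ)) ?_
  rw [← limsup_inv_mul_add (Real.logb 2 c)]
  refine limsup_le_limsup (Eventually.of_forall fun n => EReal.coe_le_coe_iff.2 ?_)
  rw [div_eq_inv_mul]
  exact mul_le_mul_of_nonneg_left (le_logb_natCast hc hL (h n)) (by positivity)

end Growth

/-! ### The integer points of a box -/

/-- The integer points of `[-R - 1, R] × [-S - 1, S]` obtained as floors of points of
`[-R, R] × [-S, S]`. -/
def floorBox (R S : ℝ) : Finset (ℤ × ℤ) := Finset.Icc ⌊-R⌋ ⌊R⌋ ×ˢ Finset.Icc ⌊-S⌋ ⌊S⌋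

theorem floor_mem_floorBox {R S x y : ℝ} (hx : |x| ≤ R) (hy : |y| ≤ S) :
    (⌊x⌋, ⌊y⌋) ∈ floorBox R S := by
  rw [abs_le] at hx hy
  simp only [floorBox, Finset.mem_product, Finset.mem_Icc]
  exact ⟨⟨Int.floor_mono hx.1, Int.floor_mono hx.2⟩, Int.floor_mono hy.1, Int.floor_mono hy.2⟩

theorem card_Icc_floor_le {R : ℝ} (hR : 0 ≤ R) :
    ((Finset.Icc ⌊-R⌋ ⌊R⌋).card : ℝ) ≤ 2 * R + 2 := by
  have h : ⌊-R⌋ ≤ ⌊R⌋ := Int.floor_mono (by linarith)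
  have h1 : ((Finset.Icc ⌊-R⌋ ⌊R⌋).card : ℤ) = ⌊R⌋ + 1 - ⌊-R⌋ := by
    rw [Int.card_Icc, Int.toNat_of_nonneg (by omega)]
  have h2 : ((Finset.Icc ⌊-R⌋ ⌊R⌋).card : ℝ) = ⌊R⌋ + 1 - ⌊-R⌋ := by exact_mod_cast h1
  rw [h2]
  linarith [Int.floor_le R, Int.lt_floor_add_one (-R)]

theorem card_floorBox_le {K L : ℝ} (hK : 0 ≤ K) (hL : 1 ≤ L) (n : ℕ) :
    ((floorBox (K * L ^ n) K).card : ℝ) ≤ (2 * K + 2) ^ 2 * L ^ n := by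
  have hpow : 1 ≤ L ^ n := one_le_pow₀ hL
  rw [floorBox, Finset.card_product, Nat.cast_mul]
  calc _ ≤ (2 * (K * L ^ n) + 2) * (2 * K + 2) :=
        mul_le_mul (card_Icc_floor_le (by positivity)) (card_Icc_floor_le hK) (by positivity)
          (by positivity)
    _ ≤ _ := by nlinarith [mul_nonneg hK (sub_nonneg.2 hpow)]

/-! ### The torus and its universal cover -/

theorem dist_torusMk_le (w z : ℝ × ℝ) : dist (torusMk w) (torusMk z) ≤ ‖w - z‖ := by
  have h : ∀ x y : ℝ, dist (x : UnitAddCircle) (y : UnitAddCircle) ≤ |x - y| := fun x y => by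
    rw [dist_eq_norm, ← AddCircle.coe_sub]
    exact QuotientAddGroup.norm_mk_le_norm
  exact max_le_max (h _ _) (h _ _)

theorem dist_torusMk_eq {w z : ℝ × ℝ} (hwz : ‖w - z‖ ≤ 1 / 2) :
    dist (torusMk w) (torusMk z) = ‖w - z‖ := by
  have h : ∀ x y : ℝ, |x - y| ≤ 1 / 2 →
      dist (x : UnitAddCircle) (y : UnitAddCircle) = |x - y| := fun x y hxy => by
    rw [dist_eq_norm, ← AddCircle.coe_sub]
    exact (AddCircle.norm_coe_eq_abs_iff 1 one_ne_zero).2 (by simpa using hxy)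
  change max _ _ = max _ _
  exact congrArg₂ max (h _ _ ((le_max_left _ _).trans hwz)) (h _ _ ((le_max_right _ _).trans hwz))

theorem exists_lift_norm_sub_eq (x : Torus2) (z : ℝ × ℝ) :
    ∃ w : ℝ × ℝ, torusMk w = x ∧ ‖w - z‖ = dist x (torusMk z) := by
  have h : ∀ (x : UnitAddCircle) (z : ℝ), ∃ w : ℝ, (w : UnitAddCircle) = x ∧
      |w - z| = dist x (z : UnitAddCircle) := by
    intro x z
    obtain ⟨y, rfl⟩ := QuotientAddGroup.mk_surjective x
    refine ⟨y - round (y - z), ?_, ?_⟩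
    · rw [AddCircle.coe_sub]
      have : ((round (y - z) : ℝ) : UnitAddCircle) = 0 :=
        (AddCircle.coe_eq_zero_iff 1).2 ⟨round (y - z), by simp⟩
      rw [this, sub_zero]
    · rw [dist_eq_norm]
      have := UnitAddCircle.norm_eq (x := y - z)
      rw [AddCircle.coe_sub] at this
      rw [show y - round (y - z) - z = y - z - round (y - z) by ring]
      exact this.symm
  obtain ⟨a, ha, ha'⟩ := h x.1 z.1
  obtain ⟨b, hb, hb'⟩ := h x.2 z.2
  exact ⟨(a, b), Prod.ext ha hb, congrArg₂ max ha' hb'⟩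

theorem exists_lift_norm_le_one (x : Torus2) : ∃ w : ℝ × ℝ, torusMk w = x ∧ ‖w‖ ≤ 1 := by
  obtain ⟨w, hw, hd⟩ := exists_lift_norm_sub_eq x 0
  refine ⟨w, hw, ?_⟩
  rw [sub_zero] at hd
  have h : ∀ y : UnitAddCircle, ‖y‖ ≤ 1 := fun y =>
    (AddCircle.norm_le_half_period 1 one_ne_zero).trans (by norm_num)
  rw [hd, show torusMk 0 = 0 from rfl, dist_zero_right]
  exact max_le (h _) (h _)

/-- The action of an integer matrix on the universal cover `ℝ²` of the torus. -/
def toralLift (A : Matrix (Fin 2) (Fin 2) ℤ) (w : ℝ × ℝ) : ℝ × ℝ :=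
  (A 0 0 * w.1 + A 0 1 * w.2, A 1 0 * w.1 + A 1 1 * w.2)

theorem torusMatMap_iterate_torusMk (A : Matrix (Fin 2) (Fin 2) ℤ) (n : ℕ) (w : ℝ × ℝ) :
    (torusMatMap A)^[n] (torusMk w) = torusMk ((toralLift A)^[n] w) := by
  have h : Function.Semiconj torusMk (toralLift A) (torusMatMap A) := fun w => by
    simp only [torusMk, toralLift, torusMatMap, AddCircle.coe_add, ← zsmul_eq_mul,
      AddCircle.coe_zsmul]
  exact ((h.iterate_right n) w).symm

/-! ### Hyperbolic splittings -/

/-- A splitting of `ℝ²` into eigenlines of `A`, spanned by unit vectors `u` and `v`, with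
coordinate functionals `p` and `q`. -/
structure HyperbolicSplitting (A : Matrix (Fin 2) (Fin 2) ℤ) (lam1 lam2 : ℝ) where
  u : ℝ × ℝ
  v : ℝ × ℝ
  p : ℝ × ℝ →L[ℝ] ℝ
  q : ℝ × ℝ →L[ℝ] ℝ
  norm_u : ‖u‖ = 1
  norm_v : ‖v‖ = 1
  lift_eq : ∀ a b : ℝ, toralLift A (a • u + b • v) = (lam1 * a) • u + (lam2 * b) • v
  decomp : ∀ w, w = p w • u + q w • v
  one_lt : 1 < |lam1|
  lt_one : |lam2| < 1

theorem nonempty_hyperbolicSplitting (A : Matrix (Fin 2) (Fin 2) ℤ) (hdet : A.det.natAbs = 1)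
    (lam1 lam2 : ℝ)
    (hchar : (A.map (Int.cast : ℤ → ℝ)).charpoly =
      (Polynomial.X - Polynomial.C lam1) * (Polynomial.X - Polynomial.C lam2))
    (h1 : 1 < |lam1|) (h2 : |lam2| < 1) : Nonempty (HyperbolicSplitting A lam1 lam2) := by
  have heval : ∀ t : ℝ, t ^ 2 - (A 0 0 + A 1 1) * t + (A 0 0 * A 1 1 - A 0 1 * A 1 0) =
      (t - lam1) * (t - lam2) := fun t => by
    have := congrArg (Polynomial.eval t) hchar
    simpa [Matrix.charpoly_fin_two, Matrix.trace_fin_two, Matrix.det_fin_two] using this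
  have hr1 := heval lam1
  have hr2 := heval lam2
  have hne : lam1 - lam2 ≠ 0 := fun h => by
    rw [sub_eq_zero.1 h] at h1
    linarith
  have hb : (A 0 1 : ℝ) ≠ 0 := by
    intro hb
    have hb' : A 0 1 = 0 := by exact_mod_cast hb
    rw [Matrix.det_fin_two, hb', zero_mul, sub_zero, Int.natAbs_mul] at hdet
    have habs : ∀ z : ℤ, z.natAbs = 1 → |(z : ℝ)| = 1 := fun z hz => by
      rw [← Int.cast_abs, Int.abs_eq_natAbs, hz]
      simp
    rw [hb] at hr1
    have : (lam1 - A 0 0) * (lam1 - A 1 1) = 0 := by linear_combination hr1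
    rcases mul_eq_zero.1 this with h | h
    · rw [sub_eq_zero.1 h, habs _ (Nat.eq_one_of_mul_eq_one_right hdet)] at h1
      exact lt_irrefl _ h1
    · rw [sub_eq_zero.1 h, habs _ (Nat.eq_one_of_mul_eq_one_left hdet)] at h1
      exact lt_irrefl _ h1
  set u₀ : ℝ × ℝ := (A 0 1, lam1 - A 0 0) with hu₀
  set v₀ : ℝ × ℝ := (A 0 1, lam2 - A 0 0) with hv₀
  have hu : ‖u₀‖ ≠ 0 := norm_ne_zero_iff.2 fun h => hb (congrArg Prod.fst h)
  have hv : ‖v₀‖ ≠ 0 := norm_ne_zero_iff.2 fun h => hb (congrArg Prod.fst h)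
  refine ⟨{
    u := ‖u₀‖⁻¹ • u₀
    v := ‖v₀‖⁻¹ • v₀
    p := (‖u₀‖ / (A 0 1 * (lam1 - lam2))) •
      ((A 0 1 : ℝ) • ContinuousLinearMap.snd ℝ ℝ ℝ -
        (lam2 - A 0 0) • ContinuousLinearMap.fst ℝ ℝ ℝ)
    q := (‖v₀‖ / (A 0 1 * (lam1 - lam2))) •
      ((lam1 - A 0 0) • ContinuousLinearMap.fst ℝ ℝ ℝ -
        (A 0 1 : ℝ) • ContinuousLinearMap.snd ℝ ℝ ℝ)
    norm_u := by rw [norm_smul, norm_inv, norm_norm, inv_mul_cancel₀ hu]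
    norm_v := by rw [norm_smul, norm_inv, norm_norm, inv_mul_cancel₀ hv]
    lift_eq := fun a b => ?_
    decomp := fun w => ?_
    one_lt := h1
    lt_one := h2 }⟩
  · generalize ‖u₀‖⁻¹ = s
    generalize ‖v₀‖⁻¹ = t
    ext
    · simp only [toralLift, hu₀, hv₀, Prod.fst_add, Prod.snd_add, Prod.smul_fst, Prod.smul_snd,
        smul_eq_mul]
      ring
    · simp only [toralLift, hu₀, hv₀, Prod.fst_add, Prod.snd_add, Prod.smul_fst, Prod.smul_snd,
        smul_eq_mul]
      linear_combination (-(a * s)) * hr1 - b * t * hr2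
  · generalize ‖u₀‖ = s at *
    generalize ‖v₀‖ = t at *
    ext
    · simp [hu₀, hv₀]
      field_simp
      ring
    · simp [hu₀, hv₀]
      field_simp
      ring

namespace HyperbolicSplitting

variable {A : Matrix (Fin 2) (Fin 2) ℤ} {lam1 lam2 : ℝ} (H : HyperbolicSplitting A lam1 lam2)

include H in
theorem lam1_ne_zero : lam1 ≠ 0 := abs_pos.1 (one_pos.trans H.one_lt)

theorem iterate_smul_add_smul (n : ℕ) (a b : ℝ) :
    (toralLift A)^[n] (a • H.u + b • H.v) = (lam1 ^ n * a) • H.u + (lam2 ^ n * b) • H.v := by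
  induction n with
  | zero => simp
  | succ n ih => rw [Function.iterate_succ_apply', ih, H.lift_eq, pow_succ', pow_succ',
      mul_assoc, mul_assoc]

theorem iterate_smul (n : ℕ) (a : ℝ) : (toralLift A)^[n] (a • H.u) = (lam1 ^ n * a) • H.u := by
  simpa using H.iterate_smul_add_smul n a 0

theorem iterate_apply (n : ℕ) (w : ℝ × ℝ) :
    (toralLift A)^[n] w = (lam1 ^ n * H.p w) • H.u + (lam2 ^ n * H.q w) • H.v := by
  conv_lhs => rw [H.decomp w]
  exact H.iterate_smul_add_smul n _ _

theorem norm_smul_add_smul_le (a b : ℝ) : ‖a • H.u + b • H.v‖ ≤ |a| + |b| := by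
  refine (norm_add_le _ _).trans ?_
  simp [norm_smul, H.norm_u, H.norm_v]

theorem norm_smul_u_sub (a b : ℝ) : ‖a • H.u - b • H.u‖ = |a - b| := by
  rw [← sub_smul, norm_smul, H.norm_u, mul_one, Real.norm_eq_abs]

theorem norm_iterate_sub_le (n : ℕ) (w z : ℝ × ℝ) :
    ‖(toralLift A)^[n] w - (toralLift A)^[n] z‖ ≤
      |lam1| ^ n * |H.p w - H.p z| + |H.q w - H.q z| := by
  have h : (toralLift A)^[n] w - (toralLift A)^[n] z =
      (lam1 ^ n * (H.p w - H.p z)) • H.u + (lam2 ^ n * (H.q w - H.q z)) • H.v := by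
    rw [H.iterate_apply, H.iterate_apply]
    module
  rw [h]
  refine (H.norm_smul_add_smul_le _ _).trans ?_
  rw [abs_mul, abs_mul, abs_pow, abs_pow]
  gcongr
  exact mul_le_of_le_one_left (abs_nonneg _) (pow_le_one₀ (abs_nonneg _) H.lt_one.le)

/-- A common bound for the norms of the coordinate functionals. -/
def bound : ℝ := max ‖H.p‖ ‖H.q‖

theorem bound_nonneg : 0 ≤ H.bound := le_max_of_le_left (norm_nonneg _)

theorem abs_p_le (w : ℝ × ℝ) : |H.p w| ≤ H.bound * ‖w‖ :=
  (H.p.le_opNorm w).trans (mul_le_mul_of_nonneg_right (le_max_left _ _) (norm_nonneg _))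

theorem abs_q_le (w : ℝ × ℝ) : |H.q w| ≤ H.bound * ‖w‖ :=
  (H.q.le_opNorm w).trans (mul_le_mul_of_nonneg_right (le_max_right _ _) (norm_nonneg _))

theorem restNum_le (n : ℕ) {ε : ℝ} (hε : 0 < ε) (x : Torus2) :
    (restNum (torusMatMap A) univ n x ε : ℝ) ≤ (2 * (2 * H.bound) + 2) ^ 2 * |lam1| ^ n := by
  classical
  obtain ⟨z, rfl, -⟩ := exists_lift_norm_sub_eq x 0
  refine le_trans ?_ (card_floorBox_le (by linarith [H.bound_nonneg]) H.one_lt.le n)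
  set s : Finset Torus2 := (floorBox (2 * H.bound * |lam1| ^ n) (2 * H.bound)).image fun ij =>
    torusMk ((toralLift A)^[n] z + ((ij.1 * (ε / 2)) • H.u + (ij.2 * (ε / 2)) • H.v))
  refine Nat.cast_le.2 ((coverNum_le_card (s := s) ?_).trans Finset.card_image_le)
  rintro _ ⟨y, ⟨hy, -⟩, rfl⟩
  obtain ⟨w, rfl, hw⟩ := exists_lift_norm_sub_eq y z
  have hwz : ‖w - z‖ ≤ ε := hw.trans_le hy.le
  have hfloor : ∀ t : ℝ, |t - ⌊t / (ε / 2)⌋ * (ε / 2)| < ε / 2 := fun t => by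
    have hpos : 0 < ε / 2 := by positivity
    have h1 := (le_div_iff₀ hpos).1 (Int.floor_le (t / (ε / 2)))
    have h2 := (div_lt_iff₀ hpos).1 (Int.lt_floor_add_one (t / (ε / 2)))
    rw [abs_of_nonneg (by linarith)]
    linarith
  set a := lam1 ^ n * (H.p w - H.p z) with ha
  set b := lam2 ^ n * (H.q w - H.q z) with hb
  have hdiff : (toralLift A)^[n] w = (toralLift A)^[n] z + (a • H.u + b • H.v) := by
    rw [H.iterate_apply, H.iterate_apply]
    module
  have habs : |a| ≤ |lam1| ^ n * (H.bound * ε) := by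
    rw [ha, abs_mul, abs_pow, ← map_sub]
    gcongr
    exact (H.abs_p_le _).trans (mul_le_mul_of_nonneg_left hwz H.bound_nonneg)
  have hbbs : |b| ≤ H.bound * ε := by
    rw [hb, abs_mul, abs_pow, ← map_sub]
    exact (mul_le_of_le_one_left (abs_nonneg _) (pow_le_one₀ (abs_nonneg _) H.lt_one.le)).trans
      ((H.abs_q_le _).trans (mul_le_mul_of_nonneg_left hwz H.bound_nonneg))
  have hmem : (⌊a / (ε / 2)⌋, ⌊b / (ε / 2)⌋) ∈
      floorBox (2 * H.bound * |lam1| ^ n) (2 * H.bound) := by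
    refine floor_mem_floorBox ?_ ?_
    · rw [abs_div, abs_of_pos (half_pos hε), div_le_iff₀ (half_pos hε)]
      linarith
    · rw [abs_div, abs_of_pos (half_pos hε), div_le_iff₀ (half_pos hε)]
      linarith
  refine mem_biUnion (Finset.mem_coe.2 (Finset.mem_image_of_mem _ hmem)) ?_
  rw [torusMatMap_iterate_torusMk, Metric.mem_ball, hdiff]
  refine (dist_torusMk_le _ _).trans_lt ?_
  rw [add_sub_add_left_eq_sub, add_sub_add_comm, ← sub_smul, ← sub_smul]
  refine (H.norm_smul_add_smul_le _ _).trans_lt ?_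
  linarith [hfloor a, hfloor b]

include H in
theorem le_restNum (n : ℕ) {ε : ℝ} (hε : 0 < ε) (hsmall : ε * |lam1| ^ n ≤ 1 / 2) :
    1 / 2 * |lam1| ^ n ≤ restNum (torusMatMap A) univ n 0 ε := by
  classical
  have hdist : ∀ j k : ℕ, j < ⌈1 / 2 * |lam1| ^ n⌉₊ → k < ⌈1 / 2 * |lam1| ^ n⌉₊ →
      dist (torusMk ((2 * ε * j) • H.u)) (torusMk ((2 * ε * k) • H.u)) =
        2 * ε * |(j : ℝ) - k| := by
    intro j k hj hk
    rw [Nat.lt_ceil] at hj hk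
    have habs : |(j : ℝ) - k| ≤ 1 / 2 * |lam1| ^ n :=
      abs_sub_le_of_nonneg_of_le (by positivity) hj.le (by positivity) hk.le
    have hn : ‖(2 * ε * j) • H.u - (2 * ε * k) • H.u‖ = 2 * ε * |(j : ℝ) - k| := by
      rw [H.norm_smul_u_sub, ← mul_sub, abs_mul, abs_of_pos (by positivity)]
    rw [dist_torusMk_eq, hn]
    rw [hn]
    nlinarith
  have hsep : ∀ j k : ℕ, j ≠ k → 1 ≤ |(j : ℝ) - k| := fun j k hjk => by
    have : (1 : ℤ) ≤ |(j : ℤ) - k| := Int.one_le_abs (sub_ne_zero.2 (by exact_mod_cast hjk))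
    exact_mod_cast this
  set P : Finset Torus2 := (Finset.range ⌈1 / 2 * |lam1| ^ n⌉₊).image
    fun j : ℕ => torusMk ((2 * ε * j) • H.u)
  have hcard : P.card = ⌈1 / 2 * |lam1| ^ n⌉₊ := by
    rw [Finset.card_image_of_injOn, Finset.card_range]
    intro j hj k hk hjk
    by_contra hne
    have h := hdist j k (Finset.mem_range.1 hj) (Finset.mem_range.1 hk)
    rw [dist_eq_zero.2 hjk] at h
    nlinarith [hsep j k hne]
  refine (Nat.le_ceil _).trans (Nat.cast_le.2 (hcard.symm.trans_le (card_le_coverNum hε ?_ ?_)))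
  · intro y hy
    obtain ⟨j, hj, rfl⟩ := Finset.mem_image.1 (Finset.mem_coe.1 hy)
    rw [Finset.mem_range, Nat.lt_ceil] at hj
    have hpow : 0 < |lam1| ^ n := pow_pos (one_pos.trans H.one_lt) n
    refine ⟨torusMk ((2 * ε * j / lam1 ^ n) • H.u), ⟨?_, mem_univ _⟩, ?_⟩
    · rw [Metric.mem_ball, show (0 : Torus2) = torusMk 0 from rfl]
      refine (dist_torusMk_le _ _).trans_lt ?_
      rw [sub_zero, norm_smul, H.norm_u, mul_one, Real.norm_eq_abs, abs_div, abs_pow,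
        abs_of_nonneg (by positivity), div_lt_iff₀ hpow]
      nlinarith
    · rw [torusMatMap_iterate_torusMk, H.iterate_smul,
        mul_div_cancel₀ _ (pow_ne_zero n H.lam1_ne_zero)]
  · intro y hy z hz hyz
    obtain ⟨j, hj, rfl⟩ := Finset.mem_image.1 hy
    obtain ⟨k, hk, rfl⟩ := Finset.mem_image.1 hz
    rw [hdist j k (Finset.mem_range.1 hj) (Finset.mem_range.1 hk)]
    have := hsep j k fun h => hyz (by rw [h])
    nlinarith

theorem card_le_of_isDynSeparated (n : ℕ) {ε : ℝ} (hε : 0 < ε) {F : Finset Torus2}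
    (hF : IsDynSeparated (torusMatMap A) univ n ε F) :
    F.card ≤ (floorBox (H.bound / (ε / 2) * |lam1| ^ n) (H.bound / (ε / 2))).card := by
  have hδ : 0 < ε / 2 := half_pos hε
  have hpow : 0 < |lam1| ^ n := pow_pos (one_pos.trans H.one_lt) n
  choose g hg hg1 using exists_lift_norm_le_one
  refine Finset.card_le_card_of_injOn
    (fun x => (⌊H.p (g x) * |lam1| ^ n / (ε / 2)⌋, ⌊H.q (g x) / (ε / 2)⌋)) ?_ ?_
  · intro x _
    have hp : |H.p (g x)| ≤ H.bound :=
      (H.abs_p_le _).trans (mul_le_of_le_one_right H.bound_nonneg (hg1 x))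
    have hq : |H.q (g x)| ≤ H.bound :=
      (H.abs_q_le _).trans (mul_le_of_le_one_right H.bound_nonneg (hg1 x))
    refine floor_mem_floorBox ?_ ?_
    · rw [abs_div, abs_of_pos hδ, abs_mul, abs_of_pos hpow, div_mul_eq_mul_div]
      gcongr
    · rw [abs_div, abs_of_pos hδ]
      gcongr
  · intro x hx y hy hxy
    by_contra hne
    obtain ⟨i, hi, hd⟩ := hF.2 x hx y hy hne
    obtain ⟨hp, hq⟩ := Prod.mk.inj hxy
    have hp := Int.abs_sub_lt_one_of_floor_eq_floor hp
    have hq := Int.abs_sub_lt_one_of_floor_eq_floor hq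
    rw [← sub_div, abs_div, abs_of_pos hδ, div_lt_one hδ] at hp hq
    rw [← sub_mul, abs_mul, abs_of_pos hpow] at hp
    refine hd.not_gt ?_
    rw [← hg x, ← hg y, torusMatMap_iterate_torusMk, torusMatMap_iterate_torusMk]
    refine (dist_torusMk_le _ _).trans_lt ((H.norm_iterate_sub_le _ _ _).trans_lt ?_)
    have hmono : |lam1| ^ i ≤ |lam1| ^ n := pow_le_pow_right₀ H.one_lt.le hi.le
    nlinarith [mul_le_mul_of_nonneg_right hmono (abs_nonneg (H.p (g x) - H.p (g y)))]

include H in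
theorem le_sepNum (n : ℕ) :
    |lam1| ^ n ≤ sepNum (torusMatMap A) univ n (1 / (2 * |lam1|)) := by
  classical
  have hL := H.one_lt
  have hL0 : 0 < |lam1| := one_pos.trans hL
  have hpow : 0 < |lam1| ^ n := pow_pos hL0 n
  have hsep : ∀ j k : ℕ, j < ⌈|lam1| ^ n⌉₊ → k < ⌈|lam1| ^ n⌉₊ → j ≠ k → ∃ i < n,
      1 / (2 * |lam1|) ≤
        dist ((torusMatMap A)^[i] (torusMk ((j / (2 * |lam1| ^ n)) • H.u)))
          ((torusMatMap A)^[i] (torusMk ((k / (2 * |lam1| ^ n)) • H.u))) := by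
    intro j k hj hk hjk
    rw [Nat.lt_ceil] at hj hk
    have hm1 : 1 ≤ |(j : ℝ) - k| := by
      have : (1 : ℤ) ≤ |(j : ℤ) - k| := Int.one_le_abs (sub_ne_zero.2 (by exact_mod_cast hjk))
      exact_mod_cast this
    have hmL : |(j : ℝ) - k| < |lam1| ^ n := by
      rw [abs_lt]
      constructor <;> linarith [(Nat.cast_nonneg j : (0 : ℝ) ≤ j), (Nat.cast_nonneg k : (0 : ℝ) ≤ k)]
    obtain ⟨r, hr, hr'⟩ := exists_nat_pow_near hm1 hL
    have hrn : r < n := (pow_lt_pow_iff_right₀ hL).1 (hr.trans_lt hmL)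
    obtain ⟨i, rfl⟩ : ∃ i, n = i + r + 1 := ⟨n - r - 1, by omega⟩
    refine ⟨i, by omega, ?_⟩
    have hi : 0 < |lam1| ^ i := pow_pos hL0 i
    have hnorm : ‖(lam1 ^ i * (j / (2 * |lam1| ^ (i + r + 1)))) • H.u -
        (lam1 ^ i * (k / (2 * |lam1| ^ (i + r + 1)))) • H.u‖ =
          |lam1| ^ i * |(j : ℝ) - k| / (2 * |lam1| ^ (i + r + 1)) := by
      rw [H.norm_smul_u_sub, ← mul_sub, ← sub_div, abs_mul, abs_pow, abs_div,
        abs_of_pos (by positivity : 0 < 2 * |lam1| ^ (i + r + 1)), mul_div_assoc]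
    rw [torusMatMap_iterate_torusMk, torusMatMap_iterate_torusMk, H.iterate_smul,
      H.iterate_smul, dist_torusMk_eq, hnorm]
    · rw [div_le_div_iff₀ (by positivity) (by positivity)]
      calc 1 * (2 * |lam1| ^ (i + r + 1)) = |lam1| ^ i * |lam1| ^ r * (2 * |lam1|) := by ring
        _ ≤ _ := by gcongr
    · rw [hnorm, div_le_div_iff₀ (by positivity) (by positivity)]
      calc |lam1| ^ i * |(j : ℝ) - k| * 2 ≤ |lam1| ^ i * |lam1| ^ (r + 1) * 2 := by gcongr
        _ = _ := by ring
  set F : Finset Torus2 := (Finset.range ⌈|lam1| ^ n⌉₊).image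
    fun j : ℕ => torusMk ((j / (2 * |lam1| ^ n)) • H.u)
  have hcard : F.card = ⌈|lam1| ^ n⌉₊ := by
    rw [Finset.card_image_of_injOn, Finset.card_range]
    intro j hj k hk hjk
    by_contra hne
    obtain ⟨i, -, hd⟩ := hsep j k (Finset.mem_range.1 hj) (Finset.mem_range.1 hk) hne
    have hjk' : torusMk ((j / (2 * |lam1| ^ n)) • H.u) =
      torusMk ((k / (2 * |lam1| ^ n)) • H.u) := hjk
    rw [hjk', dist_self] at hd
    exact hd.not_gt (by positivity)
  refine (Nat.le_ceil _).trans (Nat.cast_le.2 (hcard.symm.trans_le (card_le_sepNum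
    (fun F hF => H.card_le_of_isDynSeparated n (by positivity) hF) ⟨subset_univ _, ?_⟩)))
  intro y hy z hz hyz
  obtain ⟨j, hj, rfl⟩ := Finset.mem_image.1 hy
  obtain ⟨k, hk, rfl⟩ := Finset.mem_image.1 hz
  exact hsep j k (Finset.mem_range.1 hj) (Finset.mem_range.1 hk) fun h => hyz (by rw [h])

include H in
theorem restEntropy_eq : restEntropy (torusMatMap A) = (Real.logb 2 |lam1| : EReal) := by
  refine le_antisymm
    (restEntropy_le (C := (2 * (2 * H.bound) + 2) ^ 2) (by nlinarith [H.bound_nonneg]) H.one_lt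
      fun n ε hε x => H.restNum_le n hε x)
    (le_restEntropy (c := 1 / 2) (by norm_num) H.one_lt fun n => ?_)
  have hpow : 0 < |lam1| ^ n := pow_pos (one_pos.trans H.one_lt) n
  filter_upwards [Ioc_mem_nhdsGT (by positivity : 0 < 1 / 2 / |lam1| ^ n)] with ε hε
  exact ⟨0, H.le_restNum n hε.1 ((le_div_iff₀ hpow).1 hε.2)⟩

include H in
theorem topEntropy_eq : topEntropy (torusMatMap A) = (Real.logb 2 |lam1| : EReal) := by
  refine le_antisymm (topEntropy_le H.one_lt fun ε hε => ?_)
    (le_topEntropy (ε := 1 / (2 * |lam1|)) (c := 1) ?_ one_pos H.one_lt fun n => ?_)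
  · have hK : 0 ≤ H.bound / (ε / 2) := div_nonneg H.bound_nonneg (by positivity)
    exact ⟨(2 * (H.bound / (ε / 2)) + 2) ^ 2, by nlinarith, fun n =>
      (Nat.cast_le.2 (sepNum_le fun F hF => H.card_le_of_isDynSeparated n hε hF)).trans
        (card_floorBox_le hK H.one_lt.le n)⟩
  · have := one_pos.trans H.one_lt
    positivity
  · rw [one_mul]
    exact H.le_sepNum n

end HyperbolicSplitting

/-- Let `A` be an integer `2×2` matrix with `|det A| = 1` whose
eigenvalues `λ₁, λ₂` (the roots of its characteristic polynomial over `ℝ`) satisfy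
`|λ₁| > 1 > |λ₂|`, and let `T_A : T² → T²` be the induced hyperbolic linear torus
automorphism.  Then `h_rst(T_A) = log|λ₁| = h_top(T_A)` (logs base 2). -/
theorem restEntropy_and_topEntropy_of_hyperbolic_toral_automorphism
    (A : Matrix (Fin 2) (Fin 2) ℤ) (hdet : A.det.natAbs = 1)
    (lam1 lam2 : ℝ)
    (hchar : (A.map (Int.cast : ℤ → ℝ)).charpoly =
      (Polynomial.X - Polynomial.C lam1) * (Polynomial.X - Polynomial.C lam2))
    (h1 : 1 < |lam1|) (h2 : |lam2| < 1) :
    restEntropy (torusMatMap A) = ((Real.logb 2 |lam1| : ℝ) : EReal) ∧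
    topEntropy (torusMatMap A) = ((Real.logb 2 |lam1| : ℝ) : EReal) := by
  obtain ⟨H⟩ := nonempty_hyperbolicSplitting A hdet lam1 lam2 hchar h1 h2
  exact ⟨H.restEntropy_eq, H.topEntropy_eq⟩

end
end
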